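/- Let (K,|·|) be a non-Archimedean valued field and let α, β, γ, δ, τ₁, τ₂, λ ∈ K satisfy: |α| = |β| = |γ| = |δ| = |τ₁| = |τ₂| = |βτ₂ − δτ₁| = |γτ₁ − ατ₂|, |λ| > 1, and αδ − βγ = 1. Let a be the linear map of K² given by the diagonal matrix diag(λ, λ⁻¹), let L be the matrix with rows (α, β) and (γ, δ), let τ = (τ₁, τ₂), let h be the affine map h = (L, τ) (i.e., x ↦ Lx + τ), and let b = h a h⁻¹. Then {a,b} is a basis of a free subgroup F₂ of rank two of SA(2,K), and the action of F₂ on K² is locally commutative. -/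

import Mathlib

/-- `v` is a non-Archimedean valuation on the field `K`: it is nonnegative, vanishes
exactly at `0`, is multiplicative, and satisfies the strong triangle inequality. -/
def IsNAVal {K : Type*} [Field K] (v : K → ℝ) : Prop :=
  (∀ x, 0 ≤ v x) ∧ (∀ x, v x = 0 ↔ x = 0) ∧
    (∀ x y, v (x * y) = v x * v y) ∧ (∀ x y, v (x + y) ≤ max (v x) (v y))

section abstractPart

variable {G X : Type*} [Group G] [MulAction G X]

def s5D (f : X → G) : ℕ → X → G
  | 0, _ => 1
  | n + 1, p => s5D f n (f p • p) * f p

lemma s5D_add (f : X → G) (m n : ℕ) (p : X) :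
    s5D f (m + n) p = s5D f m (s5D f n p • p) * s5D f n p := by
  induction n generalizing p with
  | zero => simp [s5D]
  | succ k ih =>
    rw [← add_assoc]
    simp only [s5D]
    rw [ih, mul_assoc, mul_smul]

lemma s5_ext (f : X → G) {g : G} {p : X} {i j : ℕ}
    (h : s5D f i p = s5D f j (g • p) * g) (m : ℕ) :
    s5D f (m + i) p = s5D f (m + j) (g • p) * g := by
  rw [s5D_add, s5D_add, mul_assoc, ← h, h, mul_smul]

lemma s5_exists (f : X → G) (S : Set G) (hS : Subgroup.closure S = ⊤)
    (hf : ∀ s ∈ S, ∀ p, f p = s ∨ f (s • p) = s⁻¹) (g : G) :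
    ∀ p, ∃ i j, s5D f i p = s5D f j (g • p) * g := by
  have hg : g ∈ Subgroup.closure S := by rw [hS]; trivial
  induction hg using Subgroup.closure_induction with
  | mem s hs =>
    intro p
    rcases hf s hs p with h | h
    · exact ⟨1, 0, by simp [s5D, h]⟩
    · exact ⟨0, 1, by simp [s5D, h]⟩
  | one => intro p; exact ⟨0, 0, by simp [s5D]⟩
  | mul x y _ _ hx hy =>
    intro p
    obtain ⟨i, j, h1⟩ := hy p
    obtain ⟨k, l, h2⟩ := hx (y • p)
    refine ⟨k + i, j + l, ?_⟩
    rw [s5_ext f h1 k, add_comm k j, s5_ext f h2 j, mul_smul, mul_assoc]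
  | inv x _ hx =>
    intro p
    obtain ⟨i, j, h⟩ := hx (x⁻¹ • p)
    refine ⟨j, i, ?_⟩
    rw [h]; simp

lemma s5_comm (f : X → G) (S : Set G) (hS : Subgroup.closure S = ⊤)
    (hf : ∀ s ∈ S, ∀ p, f p = s ∨ f (s • p) = s⁻¹) (g h : G) (p : X)
    (hg : g • p = p) (hh : h • p = p) : g * h = h * g := by
  obtain ⟨i, j, h1⟩ := s5_exists f S hS hf g p
  obtain ⟨k, l, h2⟩ := s5_exists f S hS hf h p
  have e1 := s5_ext f h1
  have e2 := s5_ext f h2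
  rw [hg] at e1
  rw [hh] at e2
  have k1 : s5D f (k + i) p = s5D f (l + j) p * (h * g) := by
    rw [e1 k, add_comm k j, e2 j, add_comm j l, mul_assoc]
  have k2 : s5D f (k + i) p = s5D f (l + j) p * (g * h) := by
    rw [add_comm k i, e2 i, add_comm i l, e1 l, mul_assoc]
  exact mul_left_cancel (k2.symm.trans k1)

open Classical in
lemma s5_of_color (s t : G) (hS : Subgroup.closure {s, t} = ⊤) (c : X → Prop)
    (hs : ∀ p (n : ℤ), n ≠ 0 → c p → ¬ c (s ^ n • p))
    (ht : ∀ p (n : ℤ), n ≠ 0 → ¬ c p → c (t ^ n • p)) (g h : G) (p : X)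
    (hg : g • p = p) (hh : h • p = p) : g * h = h * g := by
  let f : X → G := fun p =>
    if c p then (if ∃ n : ℤ, n < 0 ∧ ¬ c (t ^ n • p) then t⁻¹ else t)
    else (if ∃ n : ℤ, n < 0 ∧ c (s ^ n • p) then s⁻¹ else s)
  refine s5_comm f {s, t} hS ?_ g h p hg hh
  rintro u (rfl | rfl) p
  · by_cases h1 : c p
    · right
      have h2 := hs p 1 one_ne_zero h1
      rw [zpow_one] at h2
      have : ∃ n : ℤ, n < 0 ∧ c (u ^ n • u • p) := ⟨-1, by simp, by simpa using h1⟩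
      simp only [f, h2, this, if_true, if_false]
    · by_cases h3 : ∃ n : ℤ, n < 0 ∧ c (u ^ n • p)
      · right
        obtain ⟨n, hn, h4⟩ := h3
        have h2 : ¬ c (u • p) := by
          have := hs _ (1 - n) (by omega) h4
          rw [← mul_smul, ← zpow_add] at this
          simpa using this
        have : ∃ n : ℤ, n < 0 ∧ c (u ^ n • u • p) :=
          ⟨n - 1, by omega, by rw [← mul_smul, ← zpow_add_one]; simpa using h4⟩
        simp only [f, h2, this, if_true, if_false]
      · left
        simp only [f, h1, h3, if_false]
  · by_cases h1 : c p
    · by_cases h3 : ∃ n : ℤ, n < 0 ∧ ¬ c (u ^ n • p)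
      · right
        obtain ⟨n, hn, h4⟩ := h3
        have h2 : c (u • p) := by
          have := ht _ (1 - n) (by omega) h4
          rw [← mul_smul, ← zpow_add] at this
          simpa using this
        have : ∃ n : ℤ, n < 0 ∧ ¬ c (u ^ n • u • p) :=
          ⟨n - 1, by omega, by rw [← mul_smul, ← zpow_add_one]; simpa using h4⟩
        simp only [f, h2, this, if_true]
      · left
        simp only [f, h1, h3, if_true, if_false]
    · right
      have h2 := ht p 1 one_ne_zero h1
      rw [zpow_one] at h2
      have : ∃ n : ℤ, n < 0 ∧ ¬ c (u ^ n • u • p) := ⟨-1, by simp, by simpa using h1⟩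
      simp only [f, h2, this, if_true]

lemma s5_two_inv {S : Type*} (σ ρ : Equiv.Perm S) (hσ : ∀ p, σ (σ p) = p)
    (hρ : ∀ p, ρ (ρ p) = p) (fσ : ∀ p, σ p ≠ p) (fρ : ∀ p, ρ p ≠ p) :
    ∃ c : S → Prop, (∀ p, c (σ p) ↔ ¬ c p) ∧ (∀ p, c (ρ p) ↔ ¬ c p) := by
  have hσ1 : σ * σ = 1 := by ext p; simp [hσ]
  have hρ1 : ρ * ρ = 1 := by ext p; simp [hρ]
  have hσi : σ⁻¹ = σ := inv_eq_of_mul_eq_one_left hσ1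
  have hρi : ρ⁻¹ = ρ := inv_eq_of_mul_eq_one_left hρ1
  set θ : Equiv.Perm S := ρ * σ with hθ
  have hconj : ∀ n : ℤ, σ * θ ^ n = θ ^ (-n) * σ := by
    intro n
    have h1 : σ * θ * σ⁻¹ = θ⁻¹ := by
      rw [hθ, mul_inv_rev, hσi, hρi, mul_assoc, mul_assoc, hσ1, mul_one]
    have h2 : σ * θ ^ n * σ⁻¹ = θ ^ (-n) := by
      rw [← conj_zpow, h1, inv_zpow, zpow_neg]
    rw [← h2]; simp
  have hconj' : ∀ (n : ℤ) p, σ ((θ ^ n) p) = (θ ^ (-n)) (σ p) := fun n p => by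
    have := congrArg (fun e : Equiv.Perm S => e p) (hconj n)
    simpa using this
  let st : Setoid S := Equiv.Perm.SameCycle.setoid θ
  let sq : Quotient st → Quotient st := Quotient.map σ (by
    rintro p q ⟨n, hn⟩
    exact ⟨-n, by rw [← hconj', hn]⟩)
  have hsq : ∀ q, sq (sq q) = q := by
    intro q
    induction q using Quotient.inductionOn with
    | h p => simp [sq, Quotient.map_mk, hσ]
  have fsq : ∀ q, sq q ≠ q := by
    intro q
    induction q using Quotient.inductionOn with
    | h p =>
      intro h
      simp only [sq, Quotient.map_mk] at h
      obtain ⟨n, hn⟩ := (Quotient.exact h : θ.SameCycle (σ p) p)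
      rcases Int.even_or_odd' n with ⟨k, rfl | rfl⟩
      · apply fσ ((θ ^ (-k)) p)
        rw [hconj', neg_neg]
        have h3 : (θ ^ (-k)) p = (θ ^ (-k) * θ ^ (2 * k)) (σ p) := by
          rw [Equiv.Perm.mul_apply, hn]
        rw [h3, ← zpow_add]
        congr 2; ring
      · apply fρ ((θ ^ (-k)) p)
        have h3 : (θ ^ (-k)) p = (θ ^ (-k) * θ ^ (2 * k + 1)) (σ p) := by
          rw [Equiv.Perm.mul_apply, hn]
        have h4 : ρ ((θ ^ (-k)) p) = θ (σ ((θ ^ (-k)) p)) := by simp [hθ, hσ]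
        rw [h4, hconj', neg_neg, h3, ← zpow_add, ← Equiv.Perm.mul_apply, ← zpow_one_add]
        congr 2; ring
  classical
  obtain ⟨lo⟩ : Nonempty (LinearOrder (Quotient st)) := ⟨linearOrderOfSTO WellOrderingRel⟩
  refine ⟨fun p => (⟦p⟧ : Quotient st) < sq ⟦p⟧, ?_, ?_⟩
  · intro p
    have h1 : (⟦σ p⟧ : Quotient st) = sq ⟦p⟧ := rfl
    simp only [h1, hsq]
    exact ⟨fun h => not_lt_of_gt h, fun h => lt_of_le_of_ne (not_lt.1 h) (fsq _)⟩
  · intro p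
    have h1 : (⟦ρ p⟧ : Quotient st) = sq ⟦p⟧ := by
      apply Quotient.sound
      exact ⟨-1, by simp [hθ, hρi, hσi, hρ]⟩
    simp only [h1, hsq]
    exact ⟨fun h => not_lt_of_gt h, fun h => lt_of_le_of_ne (not_lt.1 h) (fsq _)⟩

open Classical in
lemma s5_partial {X : Type*} (R : X → X → Prop) (hsym : ∀ p q, R p q → R q p)
    (hirr : ∀ p, ¬ R p p) (hun : ∀ p q q', R p q → R p q' → q = q') :
    ∃ σ : Equiv.Perm (X × Bool), (∀ z, σ (σ z) = z) ∧ (∀ z, σ z ≠ z) ∧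
      ∀ p q e, R p q → σ (p, e) = (q, e) := by
  let F : X × Bool → X × Bool := fun z =>
    if h : ∃ q, R z.1 q then (h.choose, z.2) else (z.1, !z.2)
  have hF : ∀ p q e, R p q → F (p, e) = (q, e) := by
    intro p q e h
    have h' : ∃ q, R p q := ⟨q, h⟩
    simp only [F, dif_pos h']
    rw [hun _ _ _ h'.choose_spec h]
  have hF' : ∀ p e, (¬ ∃ q, R p q) → F (p, e) = (p, !e) := by
    intro p e h
    simp only [F, dif_neg h]
  have hinv : Function.Involutive F := by
    rintro ⟨p, e⟩
    by_cases h : ∃ q, R p q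
    · obtain ⟨q, h⟩ := h
      rw [hF p q e h, hF q p e (hsym _ _ h)]
    · rw [hF' p e h, hF' p _ h, Bool.not_not]
  refine ⟨hinv.toPerm, hinv, ?_, hF⟩
  rintro ⟨p, e⟩
  show F (p, e) ≠ (p, e)
  by_cases h : ∃ q, R p q
  · obtain ⟨q, h⟩ := h
    rw [hF p q e h]
    intro h2
    obtain rfl : q = p := congrArg Prod.fst h2
    exact hirr _ h
  · rw [hF' p e h]
    intro h2
    have := congrArg Prod.snd h2
    simp at this

lemma s5_main (s t : G) (hS : Subgroup.closure {s, t} = ⊤) (A B : X → Prop)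
    (hA : ∀ p (n : ℤ), n ≠ 0 → A p → B (s ^ n • p) ∧ ¬ A (s ^ n • p))
    (hB : ∀ p (n : ℤ), n ≠ 0 → B p → A (t ^ n • p) ∧ ¬ B (t ^ n • p))
    (hs : ∀ p, ¬ A p → ¬ B p → ∀ n : ℤ, n ≠ 0 → s ^ n • p ≠ p)
    (ht : ∀ p, ¬ A p → ¬ B p → ∀ n : ℤ, n ≠ 0 → t ^ n • p ≠ p)
    (hsu : ∀ p, ¬ A p → ¬ B p → ∀ n m : ℤ, n ≠ 0 → m ≠ 0 →
      ¬ A (s ^ n • p) → ¬ B (s ^ n • p) → ¬ A (s ^ m • p) → ¬ B (s ^ m • p) →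
      s ^ n • p = s ^ m • p)
    (htu : ∀ p, ¬ A p → ¬ B p → ∀ n m : ℤ, n ≠ 0 → m ≠ 0 →
      ¬ A (t ^ n • p) → ¬ B (t ^ n • p) → ¬ A (t ^ m • p) → ¬ B (t ^ m • p) →
      t ^ n • p = t ^ m • p)
    (g h : G) (p : X)
    (hg : g • p = p) (hh : h • p = p) : g * h = h * g := by
  have key : ∀ u : G, (∀ p, ¬ A p → ¬ B p → ∀ n : ℤ, n ≠ 0 → u ^ n • p ≠ p) →
      (∀ p, ¬ A p → ¬ B p → ∀ n m : ℤ, n ≠ 0 → m ≠ 0 →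
      ¬ A (u ^ n • p) → ¬ B (u ^ n • p) → ¬ A (u ^ m • p) → ¬ B (u ^ m • p) →
      u ^ n • p = u ^ m • p) →
      ∃ σ : Equiv.Perm (X × Bool), (∀ z, σ (σ z) = z) ∧ (∀ z, σ z ≠ z) ∧
      ∀ (p : X) (n : ℤ) (e : Bool), n ≠ 0 → ¬ A p → ¬ B p → ¬ A (u ^ n • p) →
        ¬ B (u ^ n • p) → σ (p, e) = (u ^ n • p, e) := by
    intro u hu huu
    obtain ⟨σ, h1, h2, h3⟩ := s5_partial
      (fun p q : X => ¬ A p ∧ ¬ B p ∧ ¬ A q ∧ ¬ B q ∧ ∃ n : ℤ, n ≠ 0 ∧ q = u ^ n • p)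
      (by
        rintro p q ⟨a1, a2, a3, a4, n, hn, rfl⟩
        exact ⟨a3, a4, a1, a2, -n, by omega, by simp⟩)
      (by
        rintro p ⟨a1, a2, -, -, n, hn, h⟩
        exact hu p a1 a2 n hn h.symm)
      (by
        rintro p q q' ⟨a1, a2, a3, a4, n, hn, rfl⟩ ⟨-, -, a5, a6, m, hm, rfl⟩
        exact huu p a1 a2 n m hn hm a3 a4 a5 a6)
    exact ⟨σ, h1, h2, fun p n e hn b1 b2 b3 b4 => h3 _ _ _ ⟨b1, b2, b3, b4, n, hn, rfl⟩⟩
  obtain ⟨σ, s1, s2, s3⟩ := key s hs hsu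
  obtain ⟨ρ, r1, r2, r3⟩ := key t ht htu
  obtain ⟨c, c1, c2⟩ := s5_two_inv σ ρ s1 r1 s2 r2
  refine s5_of_color s t hS (fun p => A p ∨ (¬ B p ∧ c (p, true))) ?_ ?_ g h p hg hh
  · intro p n hn hp
    by_cases hAp : A p
    · have := hA p n hn hAp
      tauto
    · obtain ⟨hBp, hc⟩ := hp.resolve_left hAp
      rintro (h1 | ⟨h1, h2⟩)
      · have := (hA _ (-n) (by omega) h1).1
        simp at this
        exact hBp this
      · by_cases h3 : A (s ^ n • p)
        · have := (hA _ (-n) (by omega) h3).1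
          simp at this
          exact hBp this
        · rw [← s3 p n true hn hAp hBp h3 h1, c1] at h2
          exact h2 hc
  · intro p n hn hp
    push Not at hp
    obtain ⟨hAp, hp⟩ := hp
    by_cases hBp : B p
    · exact Or.inl (hB p n hn hBp).1
    · have hc := hp hBp
      by_cases h3 : A (t ^ n • p)
      · exact Or.inl h3
      · right
        have h4 : ¬ B (t ^ n • p) := by
          intro h4
          have := (hB _ (-n) (by omega) h4).1
          simp at this
          exact hAp this
        refine ⟨h4, ?_⟩
        rw [← r3 p n true hn hAp hBp h3 h4, c2]
        exact hc

lemma s5_center (w : FreeGroup Bool)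
    (h : ∀ i, w * FreeGroup.of i = FreeGroup.of i * w) : w = 1 := by
  by_contra hw
  have hne : w.toWord ≠ [] := by simpa using hw
  have hred : FreeGroup.IsReduced w.toWord := FreeGroup.isReduced_toWord
  have hmk : FreeGroup.mk w.toWord = w := FreeGroup.mk_toWord
  generalize w.toWord = L at hne hred hmk
  subst hmk
  obtain ⟨x, L', rfl⟩ := List.exists_cons_of_ne_nil hne
  have h1 := h (!x.1)
  simp only [FreeGroup.of, FreeGroup.mul_mk] at h1
  have h2 : FreeGroup.IsReduced ((!x.1, true) :: x :: L') := by
    rw [FreeGroup.isReduced_cons_cons]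
    exact ⟨by simp, hred⟩
  have h3 := FreeGroup.reduce.sound h1
  rw [List.singleton_append, h2.reduce_eq] at h3
  have h4 : FreeGroup.Red (x :: L' ++ [(!x.1, true)]) ((!x.1, true) :: x :: L') := by
    rw [← h3]; exact FreeGroup.reduce.red
  have h5 := h4.sublist.eq_of_length (by simp)
  have h6 := congrArg Prod.fst (List.cons.inj h5).1
  simp at h6

end abstractPart
section valPart

variable {K : Type*} [Field K] {v : K → ℝ}

lemma s5_v_one (hv : IsNAVal v) : v 1 = 1 := by
  obtain ⟨h0, hz, hm, ha⟩ := hv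
  have h1 := hm 1 1
  rw [mul_one] at h1
  have h2 : v 1 ≠ 0 := by rw [Ne, hz]; exact one_ne_zero
  exact (mul_left_cancel₀ h2 (by rw [mul_one]; exact h1)).symm

lemma s5_v_neg (hv : IsNAVal v) (x : K) : v (-x) = v x := by
  have h1 := s5_v_one hv
  obtain ⟨h0, hz, hm, ha⟩ := hv
  have h2 : v (-1) * v (-1) = 1 := by rw [← hm]; simpa using h1
  have h3 : v (-1) = 1 := by nlinarith [h0 (-1)]
  rw [neg_eq_neg_one_mul, hm, h3, one_mul]

lemma s5_v_dom (hv : IsNAVal v) {x y : K} (h : v y < v x) : v (x + y) = v x := by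
  have hn := s5_v_neg hv y
  obtain ⟨h0, hz, hm, ha⟩ := hv
  apply le_antisymm
  · exact (ha x y).trans (max_le le_rfl h.le)
  · have h1 := ha (x + y) (-y)
    rw [add_neg_cancel_right, hn] at h1
    rcases le_max_iff.1 h1 with h2 | h2
    · exact h2
    · exact absurd h (not_lt.2 h2)

lemma s5_v_zpow (hv : IsNAVal v) (x : K) (n : ℤ) : v (x ^ n) = v x ^ n := by
  have h1 := s5_v_one hv
  obtain ⟨h0, hz, hm, ha⟩ := hv
  let f : K →*₀ ℝ := { toFun := v, map_zero' := (hz 0).2 rfl, map_one' := h1, map_mul' := hm }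
  exact map_zpow₀ f x n

lemma s5_L1 (hv : IsNAVal v) {r : ℝ} (hr : 1 ≤ r) {d e c x y : K} (hd : v d = r)
    (he : v e = r) (hc : v c = r) (hxy : v y < v x) (hx : 1 < v x) :
    v (d * x + e * y + c) = r * v x := by
  have hm := hv.2.2.1
  have h1 : v (d * x + e * y) = v (d * x) := by
    apply s5_v_dom hv
    rw [hm, hm, hd, he]; nlinarith
  have h2 : v (d * x) = r * v x := by rw [hm, hd]
  rw [s5_v_dom hv, h1, h2]
  rw [h1, h2, hc]; nlinarith

lemma s5_L2 (hv : IsNAVal v) {r : ℝ} (hr : 1 ≤ r) {d e c x y : K} (hd : v d = r)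
    (he : v e = r) (hc : v c = r) (hx : v x < 1) (hy : v y < 1) :
    v (d * x + e * y + c) = r := by
  have hm := hv.2.2.1
  rw [add_comm, s5_v_dom hv, hc]
  refine lt_of_le_of_lt (hv.2.2.2 _ _) (max_lt ?_ ?_)
  · rw [hm, hd, hc]; nlinarith
  · rw [hm, he, hc]; nlinarith

def s5E (v : K → ℝ) (x y : K) : Prop := v x = v y ∧ 1 ≤ v x

def s5T (v : K → ℝ) (x y : K) : Prop := (v x = 1 ∧ v y < 1) ∨ (v y = 1 ∧ v x < 1)

/-- all coefficients have value `r`. -/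
def s5C (v : K → ℝ) (r : ℝ) (d1 d2 c1 d3 d4 c2 : K) : Prop :=
  1 ≤ r ∧ v d1 = r ∧ v d2 = r ∧ v c1 = r ∧ v d3 = r ∧ v d4 = r ∧ v c2 = r

lemma s5_good1 (hv : IsNAVal v) {r : ℝ} {d1 d2 c1 d3 d4 c2 : K}
    (hC : s5C v r d1 d2 c1 d3 d4 c2) {x y : K} (hne : v x ≠ v y) (h1 : 1 < v x ∨ 1 < v y) :
    s5E v (d1 * x + d2 * y + c1) (d3 * x + d4 * y + c2) := by
  obtain ⟨hr, h11, h12, h13, h21, h22, h23⟩ := hC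
  rcases lt_or_gt_of_ne hne with h | h
  · have hy : 1 < v y := by rcases h1 with h1 | h1 <;> linarith
    unfold s5E
    rw [add_comm (d1 * x), add_comm (d3 * x), s5_L1 hv hr h12 h11 h13 h hy,
      s5_L1 hv hr h22 h21 h23 h hy]
    exact ⟨rfl, by nlinarith⟩
  · have hx : 1 < v x := by rcases h1 with h1 | h1 <;> linarith
    unfold s5E
    rw [s5_L1 hv hr h11 h12 h13 h hx, s5_L1 hv hr h21 h22 h23 h hx]
    exact ⟨rfl, by nlinarith⟩

lemma s5_F1 (hv : IsNAVal v) {r : ℝ} {d1 d2 c1 d3 d4 c2 : K}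
    (hC : s5C v r d1 d2 c1 d3 d4 c2) {x y : K} (hE : ¬ s5E v x y)
    (hE' : ¬ s5E v (d1 * x + d2 * y + c1) (d3 * x + d4 * y + c2)) : s5T v x y := by
  have h1 := mt (s5_good1 hv hC (x := x) (y := y))
  have h2 : ¬ (v x < 1 ∧ v y < 1) := by
    rintro ⟨hx, hy⟩
    obtain ⟨hr, h11, h12, h13, h21, h22, h23⟩ := hC
    apply hE'
    unfold s5E
    rw [s5_L2 hv hr h11 h12 h13 hx hy, s5_L2 hv hr h21 h22 h23 hx hy]
    exact ⟨rfl, hr⟩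
  have h3 : ¬ (v x ≠ v y ∧ (1 < v x ∨ 1 < v y)) := fun h => hE' (s5_good1 hv hC h.1 h.2)
  unfold s5E at hE
  unfold s5T
  clear h1 hE' hC
  grind

lemma s5_l {l : ℝ} (hl : 1 < l) {n : ℤ} (hn : n ≠ 0) :
    (1 < l ^ n ∧ l ^ (-n) < 1) ∨ (l ^ n < 1 ∧ 1 < l ^ (-n)) := by
  rcases lt_or_gt_of_ne hn with h | h
  · exact Or.inr ⟨zpow_lt_one_of_neg₀ hl h, one_lt_zpow₀ hl (by omega)⟩
  · exact Or.inl ⟨one_lt_zpow₀ hl h, zpow_lt_one_of_neg₀ hl (by omega)⟩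

lemma s5_move (hv : IsNAVal v) {lam x y : K} (hl : 1 < v lam) {n : ℤ} (hn : n ≠ 0)
    (hE : s5E v x y) : v (lam ^ n * x) ≠ v (lam ^ (-n) * y) ∧
      (1 < v (lam ^ n * x) ∨ 1 < v (lam ^ (-n) * y)) := by
  obtain ⟨h1, h2⟩ := hE
  rw [hv.2.2.1, hv.2.2.1, s5_v_zpow hv, s5_v_zpow hv, ← h1]
  rcases s5_l hl hn with ⟨h3, h4⟩ | ⟨h3, h4⟩
  · exact ⟨by nlinarith, Or.inl (by nlinarith)⟩
  · exact ⟨by nlinarith, Or.inr (by nlinarith)⟩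

lemma s5_nofix (hv : IsNAVal v) {lam x y : K} (hl : 1 < v lam) {n : ℤ} (hn : n ≠ 0)
    (hT : s5T v x y) : ¬ (lam ^ n * x = x ∧ lam ^ (-n) * y = y) := by
  rintro ⟨h1, h2⟩
  have e1 := congrArg v h1
  have e2 := congrArg v h2
  rw [hv.2.2.1, s5_v_zpow hv] at e1 e2
  rcases hT with ⟨h, -⟩ | ⟨h, -⟩ <;> simp only [h, mul_one] at e1 e2 <;>
  rcases s5_l hl hn with ⟨h3, h4⟩ | ⟨h3, h4⟩ <;> linarith

lemma s5_uniq (hv : IsNAVal v) {lam x y : K} (hl : 1 < v lam) {n m : ℤ} (hn : n ≠ 0)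
    (hm : m ≠ 0) (hT : s5T v x y) (hTn : s5T v (lam ^ n * x) (lam ^ (-n) * y))
    (hTm : s5T v (lam ^ m * x) (lam ^ (-m) * y)) : n = m := by
  have hinj : Function.Injective (fun k : ℤ => v lam ^ k) :=
    zpow_right_injective₀ (by linarith) (by linarith)
  unfold s5T at hTn hTm
  rw [hv.2.2.1, hv.2.2.1, s5_v_zpow hv, s5_v_zpow hv] at hTn hTm
  have hln := s5_l hl hn
  have hlm := s5_l hl hm
  rcases hT with ⟨h, h'⟩ | ⟨h, h'⟩ <;> rw [h, mul_one] at hTn hTm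
  · have a1 : v lam ^ (-n) * v y = 1 := by
      rcases hTn with ⟨h1, h2⟩ | ⟨h1, h2⟩
      · rcases hln with h | h <;> linarith
      · exact h1
    have a2 : v lam ^ (-m) * v y = 1 := by
      rcases hTm with ⟨h1, h2⟩ | ⟨h1, h2⟩
      · rcases hlm with h | h <;> linarith
      · exact h1
    have hy : v y ≠ 0 := by rintro h; rw [h] at a1; simp at a1
    have := hinj (mul_right_cancel₀ hy (a1.trans a2.symm))
    omega
  · have a1 : v lam ^ n * v x = 1 := by
      rcases hTn with ⟨h1, h2⟩ | ⟨h1, h2⟩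
      · exact h1
      · rcases hln with h | h <;> linarith
    have a2 : v lam ^ m * v x = 1 := by
      rcases hTm with ⟨h1, h2⟩ | ⟨h1, h2⟩
      · exact h1
      · rcases hlm with h | h <;> linarith
    have hy : v x ≠ 0 := by rintro h; rw [h] at a1; simp at a1
    exact hinj (mul_right_cancel₀ hy (a1.trans a2.symm))

end valPart

theorem statement5 {K : Type*} [Field K] (v : K → ℝ) (hv : IsNAVal v)
    (α β γ δ τ₁ τ₂ lam : K)
    (e1 : v α = v β) (e2 : v β = v γ) (e3 : v γ = v δ) (e4 : v δ = v τ₁)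
    (e5 : v τ₁ = v τ₂) (e6 : v τ₂ = v (β * τ₂ - δ * τ₁))
    (e7 : v (β * τ₂ - δ * τ₁) = v (γ * τ₁ - α * τ₂))
    (hlam : 1 < v lam) (hdet : α * δ - β * γ = 1)
    (a b : Equiv.Perm (Fin 2 → K))
    -- a is the linear map with matrix diag(λ, λ⁻¹)
    (ha : ∀ x : Fin 2 → K, a x = ![lam * x 0, lam⁻¹ * x 1])
    -- b = h a h⁻¹, where h is the affine map x ↦ L x + τ, i.e. b ∘ h = h ∘ a
    (hb : ∀ x : Fin 2 → K,
      b ![α * x 0 + β * x 1 + τ₁, γ * x 0 + δ * x 1 + τ₂] =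
        ![α * a x 0 + β * a x 1 + τ₁, γ * a x 0 + δ * a x 1 + τ₂]) :
    -- the subgroup generated by a and b lies in SA(2, K) …
    (∀ g ∈ Subgroup.closure {a, b},
      ∃ (A : Matrix (Fin 2) (Fin 2) K) (t : Fin 2 → K),
        A.det = 1 ∧ ∀ x : Fin 2 → K, g x = A.mulVec x + t) ∧
    -- … {a, b} is a free basis of it …
    Function.Injective ⇑(FreeGroup.lift fun t : Bool => if t then a else b) ∧
    -- … and its action on K² is locally commutative
    (∀ g ∈ Subgroup.closure {a, b}, ∀ h ∈ Subgroup.closure {a, b},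
      ∀ x : Fin 2 → K, g x = x → h x = x → g * h = h * g) := by
  obtain ⟨v0, vz, vm, va⟩ := id hv
  have hl0 : lam ≠ 0 := by
    rintro rfl
    rw [(vz 0).2 rfl] at hlam
    linarith
  -- coordinates
  let u : (Fin 2 → K) → K := fun p => δ * p 0 + (-β) * p 1 + (β * τ₂ - δ * τ₁)
  let w : (Fin 2 → K) → K := fun p => (-γ) * p 0 + α * p 1 + (γ * τ₁ - α * τ₂)
  have hx0 : ∀ p, α * u p + β * w p + τ₁ = p 0 := by
    intro p; simp only [u, w]; linear_combination (p 0 - τ₁) * hdet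
  have hx1 : ∀ p, γ * u p + δ * w p + τ₂ = p 1 := by
    intro p; simp only [u, w]; linear_combination (p 1 - τ₂) * hdet
  have hbp : ∀ p, b p = ![α * (lam * u p) + β * (lam⁻¹ * w p) + τ₁,
      γ * (lam * u p) + δ * (lam⁻¹ * w p) + τ₂] := by
    intro p
    have h := hb ![u p, w p]
    simp only [ha, Matrix.cons_val_zero, Matrix.cons_val_one, hx0, hx1] at h
    rw [← h]
    congr 1
    ext i; fin_cases i <;> rfl
  have hub : ∀ p, u (b p) = lam * u p := by
    intro p
    rw [hbp]
    generalize u p = U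
    generalize w p = W
    simp only [u, Matrix.cons_val_zero, Matrix.cons_val_one]
    linear_combination (lam * U) * hdet
  have hwb : ∀ p, w (b p) = lam⁻¹ * w p := by
    intro p
    rw [hbp]
    generalize u p = U
    generalize w p = W
    simp only [w, Matrix.cons_val_zero, Matrix.cons_val_one]
    linear_combination (lam⁻¹ * W) * hdet
  have scale : ∀ (g : Equiv.Perm (Fin 2 → K)) (k : (Fin 2 → K) → K) (μ : K), μ ≠ 0 →
      (∀ p, k (g p) = μ * k p) → ∀ (n : ℤ) p, k ((g ^ n) p) = μ ^ n * k p := by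
    intro g k μ hμ hk n
    induction n with
    | zero => simp
    | succ n ih => intro p; rw [add_comm, zpow_one_add, Equiv.Perm.mul_apply, hk, ih,
        zpow_one_add₀ hμ, mul_assoc]
    | pred n ih =>
      intro p
      have h1 := ih p
      have h2 : (g ^ (-(n : ℤ))) p = g ((g ^ (-(n : ℤ) - 1)) p) := by
        rw [← Equiv.Perm.mul_apply, ← zpow_one_add]
        congr 2; ring
      rw [h2, hk] at h1
      rw [zpow_sub_one₀ hμ]
      field_simp
      linear_combination h1
  have hli : lam⁻¹ ≠ 0 := inv_ne_zero hl0
  have a0 := scale a (fun p => p 0) lam hl0 (by intro p; simp [ha])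
  have a1 := scale a (fun p => p 1) lam⁻¹ hli (by intro p; simp [ha])
  have b0 := scale b u lam hl0 hub
  have b1 := scale b w lam⁻¹ hli hwb
  simp only [inv_zpow, ← zpow_neg] at a0 a1 b0 b1
  -- values of the coefficients
  have hr : 1 ≤ v α := by
    have h1 : v (α * δ + -(β * γ)) = 1 := by rw [← sub_eq_add_neg, hdet, s5_v_one hv]
    have h2 := va (α * δ) (-(β * γ))
    rw [h1, s5_v_neg hv, vm, vm, ← e3, ← e2, ← e1, max_self] at h2
    nlinarith [v0 α]
  have hC : s5C v (v α) δ (-β) (β * τ₂ - δ * τ₁) (-γ) α (γ * τ₁ - α * τ₂) := by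
    unfold s5C
    rw [s5_v_neg hv, s5_v_neg hv]
    refine ⟨hr, ?_, ?_, ?_, ?_, ?_, ?_⟩ <;> linarith
  have hC' : s5C v (v α) α β τ₁ γ δ τ₂ := by
    unfold s5C
    refine ⟨hr, ?_, ?_, ?_, ?_, ?_, ?_⟩ <;> linarith
  let A : (Fin 2 → K) → Prop := fun p => s5E v (p 0) (p 1)
  let B : (Fin 2 → K) → Prop := fun p => s5E v (u p) (w p)
  have hTa : ∀ p, ¬ A p → ¬ B p → s5T v (p 0) (p 1) := fun p h1 h2 => s5_F1 hv hC h1 h2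
  have hTb : ∀ p, ¬ A p → ¬ B p → s5T v (u p) (w p) := by
    intro p h1 h2
    refine s5_F1 hv hC' h2 ?_
    rw [hx0, hx1]; exact h1
  -- the action of the free group
  letI act : MulAction (FreeGroup Bool) (Fin 2 → K) :=
    MulAction.compHom _ (FreeGroup.lift fun t : Bool => if t then a else b)
  have hact : ∀ (g : FreeGroup Bool) (p : Fin 2 → K),
      g • p = (FreeGroup.lift (fun t : Bool => if t then a else b) g) p := fun _ _ => rfl
  have hsa : ∀ (n : ℤ) (p : Fin 2 → K), (FreeGroup.of true) ^ n • p = (a ^ n) p := by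
    intro n p; rw [hact, map_zpow, FreeGroup.lift_apply_of]; rfl
  have hsb : ∀ (n : ℤ) (p : Fin 2 → K), (FreeGroup.of false) ^ n • p = (b ^ n) p := by
    intro n p; rw [hact, map_zpow, FreeGroup.lift_apply_of]; rfl
  have hgen : Subgroup.closure {FreeGroup.of true, FreeGroup.of false} =
      (⊤ : Subgroup (FreeGroup Bool)) := by
    rw [← FreeGroup.closure_range_of]
    congr 1
    ext z; simp [or_comm, eq_comm]
  have main : ∀ (g h : FreeGroup Bool) (p : Fin 2 → K), g • p = p → h • p = p →
      g * h = h * g := by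
    intro g h p hg hh
    refine s5_main (FreeGroup.of true) (FreeGroup.of false) hgen A B
      ?_ ?_ ?_ ?_ ?_ ?_ g h p hg hh
    · intro p n hn hp
      have hmv := s5_move hv hlam hn hp
      rw [hsa]
      constructor
      · have := s5_good1 hv hC hmv.1 hmv.2
        rw [← a0, ← a1] at this
        exact this
      · intro h
        apply hmv.1
        rw [← a0, ← a1]
        exact h.1
    · intro p n hn hp
      have hmv := s5_move hv hlam hn hp
      rw [hsb]
      constructor
      · have := s5_good1 hv hC' hmv.1 hmv.2
        rw [← b0, ← b1, hx0, hx1] at this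
        exact this
      · intro h
        apply hmv.1
        rw [← b0, ← b1]
        exact h.1
    · intro p h1 h2 n hn h
      rw [hsa] at h
      apply s5_nofix hv hlam hn (hTa p h1 h2)
      rw [← a0, ← a1, h]
      exact ⟨rfl, rfl⟩
    · intro p h1 h2 n hn h
      rw [hsb] at h
      apply s5_nofix hv hlam hn (hTb p h1 h2)
      rw [← b0, ← b1, h]
      exact ⟨rfl, rfl⟩
    · intro p h1 h2 n m hn hm h3 h4 h5 h6
      have t1 := hTa _ h3 h4
      have t2 := hTa _ h5 h6
      rw [hsa, a0, a1] at t1 t2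
      rw [s5_uniq hv hlam hn hm (hTa p h1 h2) t1 t2]
    · intro p h1 h2 n m hn hm h3 h4 h5 h6
      have t1 := hTb _ h3 h4
      have t2 := hTb _ h5 h6
      rw [hsb, b0, b1] at t1 t2
      rw [s5_uniq hv hlam hn hm (hTb p h1 h2) t1 t2]
  refine ⟨?_, ?_, ?_⟩
  · intro g hg
    induction hg using Subgroup.closure_induction with
    | mem g hg =>
      rcases hg with rfl | rfl
      · refine ⟨!![lam, 0; 0, lam⁻¹], 0, by simp [Matrix.det_fin_two, hl0], ?_⟩
        intro x
        rw [ha]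
        ext i; fin_cases i <;> simp [Matrix.mulVec, dotProduct, Fin.sum_univ_two]
      · refine ⟨!![α * lam * δ - β * lam⁻¹ * γ, -(α * lam * β) + β * lam⁻¹ * α;
          γ * lam * δ - δ * lam⁻¹ * γ, -(γ * lam * β) + δ * lam⁻¹ * α],
          ![α * lam * (β * τ₂ - δ * τ₁) + β * lam⁻¹ * (γ * τ₁ - α * τ₂) + τ₁,
            γ * lam * (β * τ₂ - δ * τ₁) + δ * lam⁻¹ * (γ * τ₁ - α * τ₂) + τ₂], ?_, ?_⟩
        · rw [Matrix.det_fin_two_of]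
          have h1 : lam * lam⁻¹ = 1 := mul_inv_cancel₀ hl0
          linear_combination (lam * lam⁻¹ * (α * δ - β * γ) + lam * lam⁻¹) * hdet + h1
        · intro x
          rw [hbp]
          ext i; fin_cases i <;>
            simp [Matrix.mulVec, dotProduct, Fin.sum_univ_two, u, w] <;> ring
    | one => exact ⟨1, 0, by simp, by simp⟩
    | mul g h _ _ hg hh =>
      obtain ⟨M, t, hM, h1⟩ := hg
      obtain ⟨N, s, hN, h2⟩ := hh
      refine ⟨M * N, M.mulVec s + t, by rw [Matrix.det_mul, hM, hN, one_mul], ?_⟩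
      intro x
      rw [Equiv.Perm.mul_apply, h2, h1, Matrix.mulVec_add, Matrix.mulVec_mulVec, add_assoc]
    | inv g _ hg =>
      obtain ⟨M, t, hM, h1⟩ := hg
      have hu : IsUnit M.det := by rw [hM]; exact isUnit_one
      refine ⟨M⁻¹, -(M⁻¹.mulVec t), by rw [Matrix.det_nonsing_inv, hM]; simp, ?_⟩
      intro x
      rw [Equiv.Perm.inv_eq_iff_eq, h1, Matrix.mulVec_add, Matrix.mulVec_neg,
        Matrix.mulVec_mulVec, Matrix.mulVec_mulVec, Matrix.mul_nonsing_inv _ hu]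
      simp
  · rw [injective_iff_map_eq_one]
    intro g hg
    apply s5_center
    have hfix : ∀ p : Fin 2 → K, g • p = p := by
      intro p; rw [hact, hg]; rfl
    rintro (_ | _)
    · refine main _ _ ![τ₁, τ₂] (hfix _) ?_
      have h := hsb 1 ![τ₁, τ₂]
      rw [zpow_one, zpow_one] at h
      rw [h]
      have := hb 0
      simpa [ha] using this
    · refine main _ _ 0 (hfix _) ?_
      have h := hsa 1 0
      rw [zpow_one, zpow_one] at h
      rw [h, ha]
      ext i; fin_cases i <;> simp
  · have hlift : ∀ g ∈ Subgroup.closure {a, b}, ∃ w : FreeGroup Bool,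
        FreeGroup.lift (fun t : Bool => if t then a else b) w = g := by
      intro g hg
      have : Subgroup.closure {a, b} ≤
          (FreeGroup.lift (fun t : Bool => if t then a else b)).range := by
        rw [Subgroup.closure_le]
        rintro z (rfl | rfl)
        · exact ⟨FreeGroup.of true, by simp⟩
        · exact ⟨FreeGroup.of false, by simp⟩
      exact this hg
    intro g hg h hh x hgx hhx
    obtain ⟨g, rfl⟩ := hlift g hg
    obtain ⟨h, rfl⟩ := hlift h hh
    rw [← map_mul, main g h x hgx hhx, map_mul]
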